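/- Let s_1, ..., s_N be real numbers (calibration scores), α ∈ (0,1), and let q be the ⌈(N+1)(1-α)⌉/N empirical quantile of {s_1,...,s_N}, i.e., q equals the k-th smallest value where k = ⌈(N+1)(1-α)⌉ (assuming k ≤ N). If s_1, ..., s_N, s_{N+1} are exchangeable random variables (e.g., i.i.d.) with almost surely distinct values, then P(s_{N+1} ≤ q) ≥ 1 - α. -/

import Mathlib

open MeasureTheory

/-- The `k`-th smallest value (1-indexed) of a finite family of reals. -/
noncomputable def kthSmallest {N : ℕ} (v : Fin N → ℝ) (k : ℕ) : ℝ :=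
  (List.insertionSort (· ≤ ·) (List.ofFn v)).getD (k - 1) 0

/-- The number of entries of `x` that are strictly below `t`. -/
noncomputable def countBelow {n : ℕ} (x : Fin n → ℝ) (t : ℝ) : ℕ :=
  ∑ j, if x j < t then 1 else 0

lemma countBelow_eq_card {n : ℕ} (x : Fin n → ℝ) (t : ℝ) :
    countBelow x t = (Finset.univ.filter fun j => x j < t).card := by
  simp [countBelow]

lemma countBelow_comp_perm {n : ℕ} (x : Fin n → ℝ) (π : Equiv.Perm (Fin n)) (t : ℝ) :
    countBelow (fun i => x (π i)) t = countBelow x t :=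
  Equiv.sum_comp π fun j => if x j < t then 1 else 0

lemma measurable_countBelow {n : ℕ} (i : Fin n) :
    Measurable fun x : Fin n → ℝ => countBelow x (x i) := by
  unfold countBelow
  refine Finset.measurable_sum _ fun j _ => Measurable.ite ?_ measurable_const measurable_const
  exact measurableSet_lt (measurable_pi_apply j) (measurable_pi_apply i)

lemma insertionSort_ofFn {n : ℕ} (v : Fin n → ℝ) :
    List.insertionSort (· ≤ ·) (List.ofFn v) = List.ofFn (v ∘ Tuple.sort v) := by
  refine List.Perm.eq_of_pairwise' (r := (· ≤ ·)) (List.pairwise_insertionSort _ _) ?_ ?_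
  · rw [List.pairwise_ofFn]
    exact fun i j hij => Tuple.monotone_sort v hij.le
  · exact (List.perm_insertionSort _ _).trans (Equiv.Perm.ofFn_comp_perm _ _).symm

lemma kthSmallest_eq {n : ℕ} (v : Fin n → ℝ) (k : ℕ) (h : k - 1 < n) :
    kthSmallest v k = v (Tuple.sort v ⟨k - 1, h⟩) := by
  simp [kthSmallest, insertionSort_ofFn, h]

lemma le_kthSmallest {n : ℕ} (v : Fin n → ℝ) {k : ℕ} (hk : k ≤ n) {t : ℝ}
    (h : countBelow v t < k) : t ≤ kthSmallest v k := by
  by_contra! hlt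
  have hn : k - 1 < n := by omega
  rw [kthSmallest_eq v k hn] at hlt
  refine absurd h (not_lt.mpr ?_)
  rw [countBelow_eq_card]
  calc k = ((Finset.Iic (⟨k - 1, hn⟩ : Fin n)).map (Tuple.sort v).toEmbedding).card := by
        simp; omega
    _ ≤ _ := by
        refine Finset.card_le_card fun i hi => ?_
        obtain ⟨j, hj, rfl⟩ := Finset.mem_map.mp hi
        simpa using (Tuple.monotone_sort v (Finset.mem_Iic.mp hj)).trans_lt hlt

lemma countBelow_sort_le {n : ℕ} (x : Fin n → ℝ) (j : Fin n) :
    countBelow x (x (Tuple.sort x j)) ≤ j := by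
  rw [← countBelow_comp_perm x (Tuple.sort x), countBelow_eq_card]
  calc _ ≤ (Finset.Iio j).card := by
        refine Finset.card_le_card fun i hi => ?_
        rw [Finset.mem_Iio]
        by_contra! hji
        exact absurd (Finset.mem_filter.mp hi).2 (Tuple.monotone_sort x hji).not_gt
    _ = j := by simp

lemma le_card_countBelow_lt {n : ℕ} (x : Fin n → ℝ) {k : ℕ} (hk : k ≤ n) :
    k ≤ (Finset.univ.filter fun i => countBelow x (x i) < k).card := by
  calc k = (Finset.univ.map ((Fin.castLEEmb hk).trans (Tuple.sort x).toEmbedding)).card := by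
        simp
    _ ≤ _ := by
        refine Finset.card_le_card fun i hi => ?_
        obtain ⟨j, -, rfl⟩ := Finset.mem_map.mp hi
        simpa using (countBelow_sort_le x (Fin.castLE hk j)).trans_lt j.isLt

/-- Under exchangeability, every index is equally likely to have fewer than `k` entries below it. -/
lemma measure_countBelow_lt_eq {Ω : Type*} [MeasurableSpace Ω] (μ : Measure Ω) {n : ℕ}
    (s : Fin n → Ω → ℝ) (hmeas : ∀ i, Measurable (s i))
    (hexch : ∀ π : Equiv.Perm (Fin n),
      Measure.map (fun ω => fun i => s (π i) ω) μ = Measure.map (fun ω => fun i => s i ω) μ)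
    (k : ℕ) (i j : Fin n) :
    μ {ω | countBelow (fun l => s l ω) (s i ω) < k} =
      μ {ω | countBelow (fun l => s l ω) (s j ω) < k} := by
  have hA : MeasurableSet {x : Fin n → ℝ | countBelow x (x j) < k} :=
    measurableSet_lt (measurable_countBelow j) measurable_const
  have h := congrArg (fun ν => ν {x : Fin n → ℝ | countBelow x (x j) < k})
    (hexch (Equiv.swap i j))
  rw [Measure.map_apply (measurable_pi_lambda _ fun l => hmeas _) hA,
    Measure.map_apply (measurable_pi_lambda _ hmeas) hA] at h
  have hperm (ω : Ω) (t : ℝ) :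
      countBelow (fun l => s (Equiv.swap i j l) ω) t = countBelow (fun l => s l ω) t :=
    countBelow_comp_perm (fun l => s l ω) (Equiv.swap i j) t
  simpa [Set.preimage, hperm] using h

/-- Under exchangeability, each entry is among the `k` smallest with probability at least
`k / n`. -/
lemma le_mul_measure_countBelow_lt {Ω : Type*} [MeasurableSpace Ω] (μ : Measure Ω)
    [IsProbabilityMeasure μ] {n : ℕ} (s : Fin n → Ω → ℝ) (hmeas : ∀ i, Measurable (s i))
    (hexch : ∀ π : Equiv.Perm (Fin n),
      Measure.map (fun ω => fun i => s (π i) ω) μ = Measure.map (fun ω => fun i => s i ω) μ)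
    {k : ℕ} (hk : k ≤ n) (j : Fin n) :
    (k : ENNReal) ≤ n * μ {ω | countBelow (fun l => s l ω) (s j ω) < k} := by
  have hE (i : Fin n) : MeasurableSet {ω | countBelow (fun l => s l ω) (s i ω) < k} :=
    measurableSet_lt ((measurable_countBelow i).comp (measurable_pi_lambda _ hmeas))
      measurable_const
  calc (k : ENNReal) = ∫⁻ _, k ∂μ := by simp
    _ ≤ ∫⁻ ω, ∑ i, {ω | countBelow (fun l => s l ω) (s i ω) < k}.indicator 1 ω ∂μ := by
        refine lintegral_mono fun ω => ?_
        simpa [Set.indicator_apply] using le_card_countBelow_lt (fun l => s l ω) hk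
    _ = ∑ i, μ {ω | countBelow (fun l => s l ω) (s i ω) < k} := by
        rw [lintegral_finsetSum _ fun i _ => measurable_one.indicator (hE i)]
        exact Finset.sum_congr rfl fun i _ => lintegral_indicator_one (hE i)
    _ = n * μ {ω | countBelow (fun l => s l ω) (s j ω) < k} := by
        simp [measure_countBelow_lt_eq μ s hmeas hexch k _ j]

/-- Split conformal prediction coverage guarantee: if the scores
`s 0, ..., s N` (calibration scores `s 0, ..., s (N-1)` and test score `s N`) are
exchangeable and almost surely distinct, and `q` is the `⌈(N+1)(1-α)⌉`-th smallest
calibration score, then `P(s_{N+1} ≤ q) ≥ 1 - α`. -/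
theorem conformal_coverage_lower {Ω : Type*} [MeasurableSpace Ω]
    (μ : Measure Ω) [IsProbabilityMeasure μ]
    (N : ℕ) (s : Fin (N + 1) → Ω → ℝ) (hmeas : ∀ i, Measurable (s i))
    (hexch : ∀ π : Equiv.Perm (Fin (N + 1)),
      Measure.map (fun ω => fun i => s (π i) ω) μ = Measure.map (fun ω => fun i => s i ω) μ)
    (hdistinct : ∀ᵐ ω ∂μ, Function.Injective (fun i => s i ω))
    (α : ℝ) (hα0 : 0 < α) (hα1 : α < 1)
    (hk : ⌈((N : ℝ) + 1) * (1 - α)⌉₊ ≤ N) :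
    ENNReal.ofReal (1 - α) ≤
      μ {ω | s (Fin.last N) ω ≤
        kthSmallest (fun i : Fin N => s i.castSucc ω) ⌈((N : ℝ) + 1) * (1 - α)⌉₊} := by
  set k := ⌈((N : ℝ) + 1) * (1 - α)⌉₊ with hkdef
  have hsub : {ω | countBelow (fun l => s l ω) (s (Fin.last N) ω) < k} ⊆
      {ω | s (Fin.last N) ω ≤ kthSmallest (fun i : Fin N => s i.castSucc ω) k} := by
    intro ω hω
    refine le_kthSmallest _ hk ?_
    rw [Set.mem_ofPred_eq, countBelow, Fin.sum_univ_castSucc] at hω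
    exact (Nat.le_add_right _ _).trans_lt hω
  refine le_trans ?_ (measure_mono hsub)
  have hmul := le_mul_measure_countBelow_lt μ s hmeas hexch (hk.trans N.le_succ) (Fin.last N)
  have hceil : ENNReal.ofReal (((N : ℝ) + 1) * (1 - α)) ≤ k :=
    ENNReal.ofReal_le_of_le_toReal (by simpa using Nat.le_ceil _)
  have hN : ENNReal.ofReal ((N : ℝ) + 1) = ((N + 1 : ℕ) : ENNReal) := by
    rw [← ENNReal.ofReal_natCast]
    push_cast
    rfl
  rw [ENNReal.ofReal_mul (by positivity), hN] at hceil
  exact (ENNReal.mul_le_mul_iff_right (by simp) (ENNReal.natCast_ne_top _)).mp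
    (hceil.trans hmul)
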